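/- Let x ∈ (-τ)·ℤ_{-τ}, i.e., x = -τ·z for some z ∈ ℤ_{-τ} (equivalently, the (-τ)-expansion of x has digit 0 at position 0). Then x + 1 ∈ ℤ_{-τ} and no element of ℤ_{-τ} lies in the open interval (x, x + 1); that is, x + 1 is the (-τ)-integer immediately following x. -/

import Mathlib

/-- The Ito–Sadahiro transformation `T_{-β}` on `[l_β, r_β)`, where
`l_β = -β/(β+1)` and `r_β = 1/(β+1)`. -/
noncomputable def negT (β : ℝ) (x : ℝ) : ℝ :=
  -β * x - (⌊-β * x - (-β / (β + 1))⌋ : ℝ)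

/-- `Fin(-β)`: reals `x` such that `(-β)^k * x ∈ (l_β, r_β)` for some `k : ℤ`
and some iterate of `T_{-β}` sends it to `0`. -/
def negFin (β : ℝ) (x : ℝ) : Prop :=
  ∃ (k : ℤ) (n : ℕ), ((-β) ^ k * x ∈ Set.Ioo (-β / (β + 1)) (1 / (β + 1))) ∧
    (negT β)^[n] ((-β) ^ k * x) = 0

/-- The set `ℤ_{-β}` of `(-β)`-integers. -/
def negInt (β : ℝ) (x : ℝ) : Prop :=
  x = 0 ∨ ∃ (N : ℕ) (y : ℝ), y ∈ Set.Ioo (-β / (β + 1)) (1 / (β + 1)) ∧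
    x = (-β) ^ (N + 1) * y ∧ (negT β)^[N + 1] y = 0

/-- The `(-β)`-digit `d_{i+1}(y)` of `y ∈ [l_β, r_β)` (indices shifted so that
`negDigit β y i` is the digit `d_{i+1}(y)`). -/
noncomputable def negDigit (β : ℝ) (y : ℝ) (i : ℕ) : ℤ :=
  ⌊-β * ((negT β)^[i] y) - (-β / (β + 1))⌋

/-- The golden ratio `τ = (1+√5)/2`. -/
noncomputable def tau : ℝ := (1 + Real.sqrt 5) / 2

/-- The Rényi transformation `T_β` on `[0,1)`. -/
noncomputable def renyiT (β : ℝ) (x : ℝ) : ℝ := β * x - (⌊β * x⌋ : ℝ)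

/-- The set `ℤ_β` of (nonnegative) `β`-integers. -/
def posInt (β : ℝ) (x : ℝ) : Prop :=
  x = 0 ∨ ∃ N : ℕ, (β ^ (-(N + 1 : ℤ)) * x ∈ Set.Ico (0 : ℝ) 1) ∧
    (renyiT β)^[N + 1] (β ^ (-(N + 1 : ℤ)) * x) = 0

lemma tau_sq : tau ^ 2 = tau + 1 := by
  have h : Real.sqrt 5 ^ 2 = 5 := Real.sq_sqrt (by norm_num)
  unfold tau
  linarith

lemma lt_tau : 1.6 < tau := by
  have h : (2.2 : ℝ) < Real.sqrt 5 := Real.lt_sqrt_of_sq_lt (by norm_num)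
  unfold tau
  linarith

lemma tau_lt : tau < 1.7 := by
  have h : Real.sqrt 5 < 2.4 := (Real.sqrt_lt' (by norm_num)).2 (by norm_num)
  unfold tau
  linarith

lemma neg_tau_div_tau_add_one : -tau / (tau + 1) = 1 - tau := by
  have := lt_tau
  rw [div_eq_iff (by linarith)]
  linarith [tau_sq]

lemma one_div_tau_add_one : 1 / (tau + 1) = 2 - tau := by
  have := lt_tau
  rw [div_eq_iff (by linarith)]
  linarith [tau_sq]

lemma negT_mem_Ico (u : ℝ) : negT tau u ∈ Set.Ico (1 - tau) (2 - tau) := by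
  unfold negT
  rw [neg_tau_div_tau_add_one]
  have h₁ := Int.floor_le (-tau * u - (1 - tau))
  have h₂ := Int.lt_floor_add_one (-tau * u - (1 - tau))
  constructor <;> linarith

/-- On `[l_τ, r_τ)` the digit is `0` or `1`, and it is `1` where `T_{-τ}` attains `l_τ`. -/
lemma exists_digit {u : ℝ} (hu : u ∈ Set.Ico (1 - tau) (2 - tau)) :
    ∃ d : ℤ, 0 ≤ d ∧ d ≤ 1 ∧ -tau * u = d + negT tau u ∧ (negT tau u = 1 - tau → d = 1) := by
  have h := tau_sq
  have h₁ := lt_tau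
  have h₂ := tau_lt
  obtain ⟨hl, hr⟩ := hu
  have hlo : 0 < -tau * u - (1 - tau) := by nlinarith
  have hhi : -tau * u - (1 - tau) < 2 := by nlinarith
  refine ⟨⌊-tau * u - (1 - tau)⌋, Int.floor_nonneg.2 hlo.le, ?_, ?_, ?_⟩
  · exact Int.lt_add_one_iff.1 (Int.floor_lt.2 (by exact_mod_cast hhi))
  · unfold negT
    rw [neg_tau_div_tau_add_one]
    ring
  · intro hT
    unfold negT at hT
    rw [neg_tau_div_tau_add_one] at hT
    have hpos : (0 : ℝ) < ⌊-tau * u - (1 - tau)⌋ := by linarith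
    have hlt : (⌊-tau * u - (1 - tau)⌋ : ℝ) < 2 := (Int.floor_le _).trans_lt hhi
    have h₃ : 0 < ⌊-tau * u - (1 - tau)⌋ := by exact_mod_cast hpos
    have h₄ : ⌊-tau * u - (1 - tau)⌋ < 2 := by exact_mod_cast hlt
    omega

lemma iterate_negT_mem_Ico {y : ℝ} (hy : y ∈ Set.Ico (1 - tau) (2 - tau)) (k : ℕ) :
    (negT tau)^[k] y ∈ Set.Ico (1 - tau) (2 - tau) := by
  cases k with
  | zero => exact hy
  | succ k =>
    rw [Function.iterate_succ_apply']
    exact negT_mem_Ico _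

/-- The integer part `a + b τ` of `(-τ) ^ k * y` has its Galois conjugate in `[0, τ²)`. -/
lemma exists_integer_part {y : ℝ} (hy : y ∈ Set.Ico (1 - tau) (2 - tau)) (k : ℕ) :
    ∃ a b : ℤ, (-tau) ^ k * y = a + b * tau + (negT tau)^[k] y ∧
      (a + b - b * tau : ℝ) ∈ Set.Ico 0 (tau ^ 2) ∧
      (0 < k → (negT tau)^[k] y = 1 - tau → (1 : ℝ) ≤ a + b - b * tau) := by
  have h := tau_sq
  have h₁ := lt_tau
  induction k with
  | zero => exact ⟨0, 0, by simp, by constructor <;> norm_num; linarith, by simp⟩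
  | succ k ih =>
    obtain ⟨a, b, hab, ⟨hlo, hhi⟩, -⟩ := ih
    obtain ⟨d, hd₀, hd₁, hd, hone⟩ := exists_digit (iterate_negT_mem_Ico hy k)
    have hd₀' : (0 : ℝ) ≤ d := by exact_mod_cast hd₀
    have hd₁' : (d : ℝ) ≤ 1 := by exact_mod_cast hd₁
    have hconj : ((-b + d : ℤ) + (-a - b : ℤ) - (-a - b : ℤ) * tau : ℝ) =
        (tau - 1) * (a + b - b * tau) + d := by
      push_cast
      linear_combination (b : ℝ) * h
    refine ⟨-b + d, -a - b, ?_, ?_, ?_⟩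
    · rw [Function.iterate_succ_apply', pow_succ', mul_assoc, hab]
      push_cast
      linear_combination hd - (b : ℝ) * h
    · rw [hconj]
      constructor <;> nlinarith
    · intro _ hT
      rw [Function.iterate_succ_apply'] at hT
      rw [hconj, hone hT]
      push_cast
      nlinarith

/-- The only elements of `ℤ[τ]` in `(-1, 1)` with conjugate in `(-τ², τ²)` are `0` and `±1/τ`. -/
lemma eq_of_small_of_conj_small {p q : ℤ} (hlo : -1 < p + q * tau) (hhi : p + q * tau < 1)
    (hlo' : -tau ^ 2 < p + q - q * tau) (hhi' : p + q - q * tau < tau ^ 2) :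
    (p = 0 ∧ q = 0) ∨ (p = -1 ∧ q = 1) ∨ (p = 1 ∧ q = -1) := by
  have h := tau_sq
  have h₁ := lt_tau
  have h₂ := tau_lt
  have hq : q < 2 := by
    by_contra! hq
    have : (2 : ℝ) ≤ q := by exact_mod_cast hq
    nlinarith
  have hq' : -2 < q := by
    by_contra! hq
    have : (q : ℝ) ≤ -2 := by exact_mod_cast hq
    nlinarith
  have hp : -3 < p := by
    by_contra! hp
    have : (p : ℝ) ≤ -3 := by exact_mod_cast hp
    have : (q : ℝ) ≤ 1 := by exact_mod_cast (by omega : q ≤ 1)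
    nlinarith
  have hp' : p < 3 := by
    by_contra! hp
    have : (3 : ℝ) ≤ p := by exact_mod_cast hp
    have : (-1 : ℝ) ≤ q := by exact_mod_cast (by omega : -1 ≤ q)
    nlinarith
  interval_cases q <;> interval_cases p <;> norm_num at * <;> linarith

/-- `ℤ_{-τ}` is the set of elements of `ℤ[τ]` whose Galois conjugate lies in `[0, τ²)`. -/
lemma negInt_tau_iff (x : ℝ) : negInt tau x ↔
    ∃ m n : ℤ, x = m + n * tau ∧ (m + n - n * tau : ℝ) ∈ Set.Ico 0 (tau ^ 2) := by
  have h := tau_sq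
  have h₁ := lt_tau
  have h₂ := tau_lt
  unfold negInt
  rw [neg_tau_div_tau_add_one, one_div_tau_add_one]
  constructor
  · rintro (rfl | ⟨N, y, hy, rfl, hT⟩)
    · exact ⟨0, 0, by simp, by constructor <;> norm_num; linarith⟩
    · obtain ⟨a, b, hab, hmem, -⟩ := exists_integer_part (Set.Ioo_subset_Ico_self hy) (N + 1)
      exact ⟨a, b, by rw [hab, hT, add_zero], hmem⟩
  · rintro ⟨m, n, hx, hlo, hhi⟩
    right
    obtain ⟨N, hN⟩ := pow_unbounded_of_one_lt (|x| / (2 - tau)) (by linarith : 1 < tau)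
    have hN' : |x| < (2 - tau) * tau ^ (N + 1) := by
      rw [div_lt_iff₀ (by linarith)] at hN
      have : 0 < tau ^ N := by positivity
      rw [pow_succ]
      nlinarith [mul_pos this (by linarith : 0 < 2 - tau)]
    have hpow : (-tau) ^ (N + 1) ≠ 0 := pow_ne_zero _ (by linarith)
    have habs : |x / (-tau) ^ (N + 1)| < 2 - tau := by
      rw [abs_div, abs_pow, abs_neg, abs_of_pos (by linarith : 0 < tau),
        div_lt_iff₀ (by positivity)]
      exact hN'
    have hy : x / (-tau) ^ (N + 1) ∈ Set.Ioo (1 - tau) (2 - tau) := by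
      rw [abs_lt] at habs
      constructor <;> linarith
    refine ⟨N, _, hy, (mul_div_cancel₀ x hpow).symm, ?_⟩
    obtain ⟨a, b, hab, ⟨hlo', hhi'⟩, hone⟩ :=
      exists_integer_part (Set.Ioo_subset_Ico_self hy) (N + 1)
    obtain ⟨hTl, hTr⟩ := iterate_negT_mem_Ico (Set.Ioo_subset_Ico_self hy) (N + 1)
    rw [mul_div_cancel₀ x hpow, hx] at hab
    rw [hx] at hone hTl hTr ⊢
    have hT : (negT tau)^[N + 1] ((m + n * tau) / (-tau) ^ (N + 1)) =
        (m - a : ℤ) + (n - b : ℤ) * tau := by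
      push_cast
      linarith
    rw [hT] at hone hTl hTr ⊢
    rcases eq_of_small_of_conj_small (p := m - a) (q := n - b) (by linarith) (by linarith)
      (by push_cast; linarith) (by push_cast; linarith) with ⟨hp, hq⟩ | ⟨hp, hq⟩ | ⟨hp, hq⟩
    · simp [hp, hq]
    · rw [hp, hq] at hTr
      norm_num at hTr
      linarith
    · have hge := hone (Nat.succ_pos N) (by rw [hp, hq]; push_cast; ring)
      have hm : (m : ℝ) = a + 1 := by exact_mod_cast (by omega : m = a + 1)
      have hn : (n : ℝ) = b - 1 := by exact_mod_cast (by omega : n = b - 1)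
      rw [hm, hn] at hhi
      linarith

/-- If `x ∈ (-τ)·ℤ_{-τ}` (digit `0` at position `0`), then `x + 1`
is the `(-τ)`-integer immediately following `x`. -/
theorem successor_after_digit_zero
    (x : ℝ) (hx : ∃ z : ℝ, negInt tau z ∧ x = -tau * z) :
    negInt tau (x + 1) ∧ ∀ w : ℝ, negInt tau w → w ∉ Set.Ioo x (x + 1) := by
  have h := tau_sq
  have h₁ := lt_tau
  obtain ⟨z, hz, rfl⟩ := hx
  obtain ⟨m, n, rfl, hlo, hhi⟩ := (negInt_tau_iff z).1 hz
  have hx : -tau * (m + n * tau) = (-n : ℤ) + (-m - n : ℤ) * tau := by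
    push_cast
    linear_combination -(n : ℝ) * h
  have hconj : ((-n : ℤ) + (-m - n : ℤ) - (-m - n : ℤ) * tau : ℝ) =
      (tau - 1) * (m + n - n * tau) := by
    push_cast
    linear_combination (n : ℝ) * h
  have hc₀ : 0 ≤ (tau - 1) * (m + n - n * tau) := mul_nonneg (by linarith) hlo
  have hc₁ : (tau - 1) * (m + n - n * tau) < tau := by nlinarith
  rw [hx]
  rw [← hconj] at hc₀ hc₁
  generalize -n = a at *
  generalize -m - _ = b at *
  refine ⟨(negInt_tau_iff _).2 ⟨a + 1, b, by push_cast; ring, ?_⟩, ?_⟩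
  · push_cast
    constructor <;> linarith
  · rintro w hw ⟨hw₁, hw₂⟩
    obtain ⟨c, e, rfl, hlo', hhi'⟩ := (negInt_tau_iff w).1 hw
    rcases eq_of_small_of_conj_small (p := c - a) (q := e - b) (by push_cast; linarith)
      (by push_cast; linarith) (by push_cast; linarith) (by push_cast; linarith)
      with ⟨hp, hq⟩ | ⟨hp, hq⟩ | ⟨hp, hq⟩
    all_goals
      obtain rfl := eq_add_of_sub_eq hp
      obtain rfl := eq_add_of_sub_eq hq
      push_cast at *
      linarith
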